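/- arXiv:2111.07931 — 5 statements merged into one kernel-verified Lean document; each statement's English description precedes it below -/
import Mathlib

section
/- Let G be a group with commuting conjugates. Then the second bounded cohomology of G with trivial real coefficients vanishes; that is, every bounded 2-cocycle ω : G × G → ℝ is a bounded 2-coboundary. -/
/-- `ω : G × G → ℝ` is a bounded 2-cocycle: it is bounded and satisfies the
2-cocycle identity `ω(g₂,g₃) − ω(g₁g₂,g₃) + ω(g₁,g₂g₃) − ω(g₁,g₂) = 0`. -/
def IsBounded2Cocycle {G : Type*} [Group G] (ω : G → G → ℝ) : Prop :=
  (∃ C : ℝ, ∀ g h : G, |ω g h| ≤ C) ∧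
    ∀ g₁ g₂ g₃ : G, ω g₂ g₃ - ω (g₁ * g₂) g₃ + ω g₁ (g₂ * g₃) - ω g₁ g₂ = 0

/-- `ω : G × G → ℝ` is a bounded 2-coboundary: there is a bounded `φ : G → ℝ`
with `ω(g₁,g₂) = φ(g₂) − φ(g₁g₂) + φ(g₁)`. -/
def IsBounded2Coboundary {G : Type*} [Group G] (ω : G → G → ℝ) : Prop :=
  ∃ φ : G → ℝ, (∃ C : ℝ, ∀ g : G, |φ g| ≤ C) ∧
    ∀ g₁ g₂ : G, ω g₁ g₂ = φ g₂ - φ (g₁ * g₂) + φ g₁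

/-- Vanishing of second bounded cohomology with trivial real coefficients:
every bounded 2-cocycle is a bounded 2-coboundary. -/
def HasVanishingH2b (G : Type*) [Group G] : Prop :=
  ∀ ω : G → G → ℝ, IsBounded2Cocycle ω → IsBounded2Coboundary ω

/-- `G` has commuting conjugates: for every finitely generated subgroup `H ≤ G`
there is `f ∈ G` with `[H, f⁻¹Hf] = 1` elementwise. -/
def HasCommutingConjugates (G : Type*) [Group G] : Prop :=
  ∀ H : Subgroup G, H.FG → ∃ f : G, ∀ h₁ ∈ H, ∀ h₂ ∈ H, Commute h₁ (f⁻¹ * h₂ * f)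

theorem eq_zero_of_abs_two_pow_mul_le {a K : ℝ} (h : ∀ n : ℕ, |2 ^ n * a| ≤ K) : a = 0 := by
  by_contra ha
  obtain ⟨n, hn⟩ := pow_unbounded_of_one_lt (K / |a|) (one_lt_two (α := ℝ))
  have hn' := (div_lt_iff₀ (abs_pos.mpr ha)).mp hn
  have := h n
  rw [abs_mul, abs_of_pos (by positivity : (0 : ℝ) < 2 ^ n)] at this
  linarith

section Quasimorphism

variable {E : Type*} [Group E]

/-- A function with bounded defect is at bounded distance from one which doubles on squares. -/
theorem exists_sq_homogeneous_near {φ : E → ℝ} {C : ℝ}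
    (hφ : ∀ x y, |φ (x * y) - φ x - φ y| ≤ C) :
    ∃ ψ : E → ℝ, (∀ x, |φ x - ψ x| ≤ C) ∧ ∀ x, ψ (x ^ 2) = 2 * ψ x := by
  have hu : ∀ x, ∀ n : ℕ, dist (φ (x ^ 2 ^ n) / 2 ^ n) (φ (x ^ 2 ^ (n + 1)) / 2 ^ (n + 1))
      ≤ C / 2 / 2 ^ n := by
    intro x n
    have h := hφ (x ^ 2 ^ n) (x ^ 2 ^ n)
    rw [← pow_add, ← two_mul, ← pow_succ'] at h
    rw [dist_comm, Real.dist_eq]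
    have e : φ (x ^ 2 ^ (n + 1)) / 2 ^ (n + 1) - φ (x ^ 2 ^ n) / 2 ^ n
        = (φ (x ^ 2 ^ (n + 1)) - φ (x ^ 2 ^ n) - φ (x ^ 2 ^ n)) / 2 / 2 ^ n := by
      field_simp
      ring
    rw [e, abs_div, abs_div, abs_two, abs_of_pos (by positivity : (0 : ℝ) < 2 ^ n)]
    gcongr
  choose ψ hψ using fun x => cauchySeq_tendsto_of_complete (cauchySeq_of_le_geometric_two (hu x))
  refine ⟨ψ, fun x => ?_, fun x => ?_⟩
  · simpa [Real.dist_eq] using dist_le_of_le_geometric_two_of_tendsto₀ (hu x) (hψ x)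
  · refine tendsto_nhds_unique (hψ (x ^ 2))
      ((((hψ x).comp (Filter.tendsto_add_atTop_nat 1)).const_mul 2).congr fun n => ?_)
    simp only [Function.comp_apply, ← pow_mul, ← pow_succ']
    field_simp
    ring

variable {ψ : E → ℝ} {K : ℝ}

theorem map_pow_two_pow_of_sq (hsq : ∀ x, ψ (x ^ 2) = 2 * ψ x) (x : E) (n : ℕ) :
    ψ (x ^ 2 ^ n) = 2 ^ n * ψ x := by
  induction n with
  | zero => simp
  | succ n ih => rw [pow_succ 2 n, pow_mul, hsq, ih, pow_succ]; ring

theorem map_mul_of_commute (hsq : ∀ x, ψ (x ^ 2) = 2 * ψ x)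
    (hK : ∀ x y, |ψ (x * y) - ψ x - ψ y| ≤ K) {x y : E} (h : Commute x y) :
    ψ (x * y) = ψ x + ψ y := by
  have : ψ (x * y) - ψ x - ψ y = 0 := eq_zero_of_abs_two_pow_mul_le (K := K) fun n => by
    have := hK (x ^ 2 ^ n) (y ^ 2 ^ n)
    rwa [← h.mul_pow, map_pow_two_pow_of_sq hsq, map_pow_two_pow_of_sq hsq,
      map_pow_two_pow_of_sq hsq, ← mul_sub, ← mul_sub] at this
  linarith

theorem map_conj_of_sq (hsq : ∀ x, ψ (x ^ 2) = 2 * ψ x)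
    (hK : ∀ x y, |ψ (x * y) - ψ x - ψ y| ≤ K) (f x : E) :
    ψ (f * x * f⁻¹) = ψ x := by
  have : ψ (f * x * f⁻¹) - ψ x = 0 :=
    eq_zero_of_abs_two_pow_mul_le (K := 2 * K + |ψ f| + |ψ f⁻¹|) fun n => by
      rw [mul_sub, ← map_pow_two_pow_of_sq hsq, ← map_pow_two_pow_of_sq hsq, conj_pow]
      have h₁ := abs_le.mp (hK (f * x ^ 2 ^ n) f⁻¹)
      have h₂ := abs_le.mp (hK f (x ^ 2 ^ n))
      have h₃ := abs_le.mp (le_refl |ψ f|)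
      have h₄ := abs_le.mp (le_refl |ψ f⁻¹|)
      rw [abs_le]
      constructor <;> linarith
  linarith

/-- If every pair of elements has a simultaneous conjugate commuting with it, then a function
of bounded defect which doubles on squares is additive. -/
theorem map_mul_of_commuting_conjugates (hsq : ∀ x, ψ (x ^ 2) = 2 * ψ x)
    (hK : ∀ x y, |ψ (x * y) - ψ x - ψ y| ≤ K)
    (hc : ∀ x y : E, ∃ f : E, Commute x (f * x * f⁻¹) ∧ Commute x (f * y * f⁻¹) ∧
      Commute y (f * x * f⁻¹) ∧ Commute y (f * y * f⁻¹)) (x y : E) :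
    ψ (x * y) = ψ x + ψ y := by
  have key : ∀ n : ℕ, ∀ x y : E, |2 ^ n * (ψ (x * y) - ψ x - ψ y)| ≤ K := by
    intro n
    induction n with
    | zero => simpa using hK
    | succ n ih =>
      intro x y
      obtain ⟨f, hxx, hxy, hyx, hyy⟩ := hc x y
      have hm : f * (x * y) * f⁻¹ = (f * x * f⁻¹) * (f * y * f⁻¹) := by group
      have hcomm : Commute (x * y) (f * (x * y) * f⁻¹) := by
        rw [hm]
        exact (hxx.mul_right hxy).mul_left (hyx.mul_right hyy)
      have e₁ : ψ (x * (f * x * f⁻¹)) = ψ x + ψ x := by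
        rw [map_mul_of_commute hsq hK hxx, map_conj_of_sq hsq hK]
      have e₂ : ψ (y * (f * y * f⁻¹)) = ψ y + ψ y := by
        rw [map_mul_of_commute hsq hK hyy, map_conj_of_sq hsq hK]
      have e₃ : ψ (x * (f * x * f⁻¹) * (y * (f * y * f⁻¹))) = ψ (x * y) + ψ (x * y) := by
        rw [hyx.symm.mul_mul_mul_comm, ← hm, map_mul_of_commute hsq hK hcomm,
          map_conj_of_sq hsq hK]
      have h := ih (x * (f * x * f⁻¹)) (y * (f * y * f⁻¹))
      rw [e₁, e₂, e₃] at h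
      convert h using 2
      ring
  have := eq_zero_of_abs_two_pow_mul_le fun n => key n x y
  linarith

end Quasimorphism

/-- The central extension of `G` by `ℝ` determined by a bounded 2-cocycle. -/
@[ext]
structure CocycleExtension {G : Type*} [Group G] (ω : G → G → ℝ)
    (hω : IsBounded2Cocycle ω) where
  /-- The projection to `G`. -/
  base : G
  /-- The central coordinate. -/
  fiber : ℝ

namespace CocycleExtension

variable {G : Type*} [Group G] {ω : G → G → ℝ} {hω : IsBounded2Cocycle ω}

instance : Mul (CocycleExtension ω hω) :=
  ⟨fun x y => ⟨x.base * y.base, x.fiber + y.fiber + ω x.base y.base⟩⟩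

instance : One (CocycleExtension ω hω) := ⟨⟨1, -ω 1 1⟩⟩

instance : Inv (CocycleExtension ω hω) :=
  ⟨fun x => ⟨x.base⁻¹, -x.fiber - ω x.base⁻¹ x.base - ω 1 1⟩⟩

@[simp] theorem base_mul (x y : CocycleExtension ω hω) : (x * y).base = x.base * y.base := rfl

@[simp] theorem fiber_mul (x y : CocycleExtension ω hω) :
    (x * y).fiber = x.fiber + y.fiber + ω x.base y.base := rfl

@[simp] theorem base_one : (1 : CocycleExtension ω hω).base = 1 := rfl

@[simp] theorem fiber_one : (1 : CocycleExtension ω hω).fiber = -ω 1 1 := rfl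

@[simp] theorem base_inv (x : CocycleExtension ω hω) : x⁻¹.base = x.base⁻¹ := rfl

@[simp] theorem fiber_inv (x : CocycleExtension ω hω) :
    x⁻¹.fiber = -x.fiber - ω x.base⁻¹ x.base - ω 1 1 := rfl

instance : Group (CocycleExtension ω hω) :=
  Group.ofLeftAxioms
    (fun x y z => by
      ext
      · simp [mul_assoc]
      · have := hω.2 x.base y.base z.base
        simp only [fiber_mul, base_mul]
        linarith)
    (fun x => by
      ext
      · simp
      · have := hω.2 1 1 x.base
        simp only [one_mul] at this
        simp only [fiber_mul, fiber_one, base_one]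
        linarith)
    (fun x => by
      ext
      · simp
      · simp only [fiber_mul, fiber_inv, base_inv, fiber_one]
        ring)

/-- Translation by a central element. -/
def translate (r : ℝ) (x : CocycleExtension ω hω) : CocycleExtension ω hω :=
  ⟨x.base, x.fiber + r⟩

theorem translate_pow (r : ℝ) (x : CocycleExtension ω hω) (n : ℕ) :
    translate r x ^ n = translate (n * r) (x ^ n) := by
  induction n with
  | zero => ext <;> simp [translate]
  | succ n ih =>
    rw [pow_succ, ih, pow_succ]
    ext
    · simp [translate]
    · simp only [translate, fiber_mul]
      push_cast
      ring

theorem map_translate {ψ : CocycleExtension ω hω → ℝ} {C : ℝ}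
    (hnear : ∀ x, |x.fiber - ψ x| ≤ C) (hsq : ∀ x, ψ (x ^ 2) = 2 * ψ x) (r : ℝ)
    (x : CocycleExtension ω hω) : ψ (translate r x) = ψ x + r := by
  have : ψ (translate r x) - ψ x - r = 0 :=
    eq_zero_of_abs_two_pow_mul_le (K := 2 * C) fun n => by
      have h₁ := abs_le.mp (hnear (translate r x ^ 2 ^ n))
      have h₂ := abs_le.mp (hnear (x ^ 2 ^ n))
      rw [map_pow_two_pow_of_sq hsq] at h₁ h₂
      rw [translate_pow] at h₁
      simp only [translate, Nat.cast_pow, Nat.cast_ofNat] at h₁ ⊢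
      rw [abs_le]
      constructor <;> linarith
  linarith

theorem commute_of_commute_base {ψ : CocycleExtension ω hω → ℝ} {C K : ℝ}
    (hnear : ∀ x, |x.fiber - ψ x| ≤ C) (hsq : ∀ x, ψ (x ^ 2) = 2 * ψ x)
    (hK : ∀ x y, |ψ (x * y) - ψ x - ψ y| ≤ K) {x y : CocycleExtension ω hω}
    (h : Commute x.base y.base) : Commute x y := by
  have e : x * y = translate ((x * y).fiber - (y * x).fiber) (y * x) := by
    ext
    · exact h
    · simp [translate]
  have h₁ := map_translate hnear hsq ((x * y).fiber - (y * x).fiber) (y * x)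
  have h₂ : ψ (x * y) = ψ (y * x) := by
    rw [← map_conj_of_sq hsq hK x (y * x)]
    congr 1
    group
  rw [← e, h₂] at h₁
  ext
  · exact h
  · linarith

end CocycleExtension

/-- If `G` has commuting conjugates then `H²_b(G;ℝ) = 0`:
every bounded 2-cocycle on `G` is a bounded 2-coboundary. -/
theorem commutingConjugates_vanishing_H2b (G : Type*) [Group G]
    (hG : HasCommutingConjugates G) (ω : G → G → ℝ) (hω : IsBounded2Cocycle ω) :
    IsBounded2Coboundary ω := by
  obtain ⟨C, hC⟩ := hω.1
  obtain ⟨ψ, hnear, hsq⟩ :=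
    exists_sq_homogeneous_near (φ := (CocycleExtension.fiber : CocycleExtension ω hω → ℝ))
      (C := C) fun x y => by
        convert hC x.base y.base using 2
        rw [CocycleExtension.fiber_mul]
        ring
  have hK : ∀ x y, |ψ (x * y) - ψ x - ψ y| ≤ 4 * C := fun x y => by
    have h₁ := abs_le.mp (hnear (x * y))
    have h₂ := abs_le.mp (hnear x)
    have h₃ := abs_le.mp (hnear y)
    have h₄ := abs_le.mp (hC x.base y.base)
    rw [CocycleExtension.fiber_mul] at h₁
    rw [abs_le]
    constructor <;> linarith
  have hadd := map_mul_of_commuting_conjugates hsq hK fun x y => by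
    obtain ⟨f, hf⟩ := hG (Subgroup.closure {x.base, y.base})
      ((Subgroup.fg_iff _).mpr ⟨_, rfl, Set.toFinite _⟩)
    have hx : x.base ∈ Subgroup.closure {x.base, y.base} := Subgroup.subset_closure (by simp)
    have hy : y.base ∈ Subgroup.closure {x.base, y.base} := Subgroup.subset_closure (by simp)
    have hcomm := fun {a b : CocycleExtension ω hω} =>
      CocycleExtension.commute_of_commute_base hnear hsq hK (x := a) (y := b)
    refine ⟨⟨f⁻¹, 0⟩, hcomm ?_, hcomm ?_, hcomm ?_, hcomm ?_⟩ <;>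
      simp only [CocycleExtension.base_mul, CocycleExtension.base_inv, inv_inv] <;>
      apply hf <;> assumption
  refine ⟨fun g => ψ ⟨g, 0⟩, ⟨C, fun g => by simpa using hnear ⟨g, 0⟩⟩, fun g h => ?_⟩
  have h₁ := hadd ⟨g, 0⟩ ⟨h, 0⟩
  have h₂ := CocycleExtension.map_translate hnear hsq (ω g h) ⟨g * h, 0⟩
  have e : (⟨g, 0⟩ * ⟨h, 0⟩ : CocycleExtension ω hω)
      = CocycleExtension.translate (ω g h) ⟨g * h, 0⟩ := by
    ext <;> simp [CocycleExtension.translate]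
  rw [e, h₂] at h₁
  linarith
end

section
/- Let G be a group with a normal subgroup H such that H (as a group) has commuting conjugates and the quotient G/H is amenable. Then every bounded 2-cocycle ω : G × G → ℝ is a bounded 2-coboundary, i.e. H²_b(G;ℝ) = 0. -/
/-- `K` is amenable: there is a finitely additive left-invariant probability
measure defined on all subsets of `K`. -/
def IsAmenableGroup (K : Type*) [Group K] : Prop :=
  ∃ m : Set K → ℝ, (∀ A : Set K, 0 ≤ m A) ∧ m Set.univ = 1 ∧
    (∀ A B : Set K, Disjoint A B → m (A ∪ B) = m A + m B) ∧
    (∀ (g : K) (A : Set K), m ((fun x => g * x) '' A) = m A)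

/-- A real number all of whose natural multiples are uniformly bounded is zero. -/
theorem eq_zero_of_forall_abs_natCast_mul_le {a B : ℝ} (h : ∀ n : ℕ, |(n : ℝ) * a| ≤ B) :
    a = 0 := by
  by_contra ha
  obtain ⟨n, hn⟩ := exists_nat_gt (B / |a|)
  have := h n
  rw [abs_mul, Nat.abs_cast] at this
  rw [div_lt_iff₀ (abs_pos.2 ha)] at hn
  linarith

/-- `ρ` is a homogeneous quasimorphism on `E` with defect at most `D`. -/
structure IsHomogeneousQuasimorphism {E : Type*} [Group E] (ρ : E → ℝ) (D : ℝ) : Prop where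
  abs_sub_le : ∀ x y, |ρ (x * y) - ρ x - ρ y| ≤ D
  map_pow : ∀ (x : E) (n : ℕ), ρ (x ^ n) = n * ρ x

open Filter Topology in
/-- Every quasimorphism is at bounded distance from a homogeneous one, obtained as the limit of
`f (x ^ n) / n`. -/
theorem exists_isHomogeneousQuasimorphism {E : Type*} [Group E] {f : E → ℝ} {C : ℝ}
    (hf : ∀ x y, |f (x * y) - f x - f y| ≤ C) :
    ∃ ρ : E → ℝ, IsHomogeneousQuasimorphism ρ (4 * C) ∧ ∀ x, |f x - ρ x| ≤ C := by
  have hC : 0 ≤ C := (abs_nonneg _).trans (hf 1 1)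
  have hmul : ∀ x (n : ℕ), 0 < n → |f (x ^ n) - n * f x| ≤ n * C := by
    intro x n hn
    induction n, hn using Nat.le_induction with
    | base => simpa using hC
    | succ n hn ih =>
      have h1 := hf (x ^ n) x
      rw [← pow_succ] at h1
      rw [abs_le] at *
      push_cast
      constructor <;> linarith
  have hdist : ∀ x (n : ℕ), 0 < n → |f x - f (x ^ n) / n| ≤ C := by
    intro x n hn
    have hn' : (0 : ℝ) < n := by exact_mod_cast hn
    have h1 := hmul x n hn
    have h2 : f x - f (x ^ n) / n = -((f (x ^ n) - n * f x) / n) := by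
      field_simp
      ring
    rw [h2, abs_neg, abs_div, abs_of_pos hn', div_le_iff₀ hn']
    linarith
  have hlim : ∀ x, ∃ l, Tendsto (fun n : ℕ => f (x ^ n) / n) atTop (𝓝 l) := by
    intro x
    have hsub : Subadditive (fun n : ℕ => f (x ^ n) + C) := by
      intro m n
      have h1 := (abs_le.1 (hf (x ^ m) (x ^ n))).2
      rw [← pow_add] at h1
      linarith
    have hbdd : BddBelow (Set.range fun n : ℕ => (f (x ^ n) + C) / n) := by
      refine ⟨min 0 (f x - C), ?_⟩
      rintro _ ⟨n, rfl⟩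
      rcases Nat.eq_zero_or_pos n with rfl | hn
      · simp
      · refine (min_le_right _ _).trans ?_
        have h1 := (abs_le.1 (hdist x n hn)).2
        have h2 : 0 ≤ C / n := by positivity
        simp only [add_div]
        linarith
    refine ⟨hsub.lim, ?_⟩
    have h1 := (hsub.tendsto_lim hbdd).sub (tendsto_const_div_atTop_nhds_zero_nat C)
    simpa [add_div] using h1
  choose ρ hρ using hlim
  have hclose : ∀ x, |f x - ρ x| ≤ C := fun x =>
    le_of_tendsto ((tendsto_const_nhds.sub (hρ x)).abs)
      ((eventually_gt_atTop 0).mono fun n hn => hdist x n hn)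
  refine ⟨ρ, ⟨fun x y => ?_, fun x n => ?_⟩, hclose⟩
  · have h1 := abs_le.1 (hf x y)
    have h2 := abs_le.1 (hclose (x * y))
    have h3 := abs_le.1 (hclose x)
    have h4 := abs_le.1 (hclose y)
    rw [abs_le]
    constructor <;> linarith
  · rcases Nat.eq_zero_or_pos n with rfl | hn
    · refine tendsto_nhds_unique (hρ (x ^ 0)) ?_
      simpa using tendsto_const_div_atTop_nhds_zero_nat (f 1)
    · refine tendsto_nhds_unique (hρ (x ^ n)) ?_
      have h1 : Tendsto (fun k : ℕ => n * k) atTop atTop :=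
        tendsto_id.const_mul_atTop' hn
      refine (((hρ x).comp h1).const_mul (n : ℝ)).congr fun k => ?_
      have hn' : (n : ℝ) ≠ 0 := by exact_mod_cast hn.ne'
      simp only [Function.comp, pow_mul, Nat.cast_mul]
      rw [mul_comm, div_mul_eq_mul_div, mul_comm (n : ℝ) (k : ℝ), mul_div_mul_right _ _ hn']

namespace IsHomogeneousQuasimorphism

variable {E : Type*} [Group E] {ρ : E → ℝ} {D : ℝ}

theorem map_one (h : IsHomogeneousQuasimorphism ρ D) : ρ 1 = 0 := by
  simpa using h.map_pow 1 0

theorem map_mul_of_commute (h : IsHomogeneousQuasimorphism ρ D) {x y : E} (hxy : Commute x y) :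
    ρ (x * y) = ρ x + ρ y := by
  have : ρ (x * y) - ρ x - ρ y = 0 := by
    refine eq_zero_of_forall_abs_natCast_mul_le (B := D) fun n => ?_
    have h1 := h.abs_sub_le (x ^ n) (y ^ n)
    rw [← hxy.mul_pow, h.map_pow, h.map_pow, h.map_pow] at h1
    rwa [mul_sub, mul_sub]
  linarith

theorem map_conj (h : IsHomogeneousQuasimorphism ρ D) (x y : E) :
    ρ (y * x * y⁻¹) = ρ x := by
  have : ρ (y * x * y⁻¹) - ρ x = 0 := by
    refine eq_zero_of_forall_abs_natCast_mul_le (B := 2 * D + |ρ y| + |ρ y⁻¹|) fun n => ?_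
    have h1 := abs_le.1 (h.abs_sub_le (y * x ^ n) y⁻¹)
    have h2 := abs_le.1 (h.abs_sub_le y (x ^ n))
    rw [← conj_pow, h.map_pow] at h1
    rw [h.map_pow] at h2
    have h3 := neg_abs_le (ρ y)
    have h4 := le_abs_self (ρ y)
    have h5 := neg_abs_le (ρ y⁻¹)
    have h6 := le_abs_self (ρ y⁻¹)
    rw [abs_le, mul_sub]
    constructor <;> linarith
  linarith

theorem const_mul (h : IsHomogeneousQuasimorphism ρ D) {c : ℝ} (hc : 0 ≤ c) :
    IsHomogeneousQuasimorphism (fun x => c * ρ x) (c * D) where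
  abs_sub_le x y := by
    rw [← mul_sub, ← mul_sub, abs_mul, abs_of_nonneg hc]
    exact mul_le_mul_of_nonneg_left (h.abs_sub_le x y) hc
  map_pow x n := by rw [h.map_pow]; ring

/-- A homogeneous quasimorphism at bounded distance from a function of defect at most `c` has
defect at most `4 * c`, whatever the distance. -/
theorem of_abs_sub_le (h : IsHomogeneousQuasimorphism ρ D) {ψ : E → ℝ} {B c : ℝ}
    (hB : ∀ x, |ψ x - ρ x| ≤ B) (hc : ∀ x y, |ψ (x * y) - ψ x - ψ y| ≤ c) :
    IsHomogeneousQuasimorphism ρ (4 * c) := by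
  obtain ⟨σ, hσ, hσc⟩ := exists_isHomogeneousQuasimorphism hc
  have : σ = ρ := by
    funext x
    have : σ x - ρ x = 0 := by
      refine eq_zero_of_forall_abs_natCast_mul_le (B := B + c) fun n => ?_
      have h1 := abs_le.1 (hB (x ^ n))
      have h2 := abs_le.1 (hσc (x ^ n))
      rw [h.map_pow] at h1
      rw [hσ.map_pow] at h2
      rw [abs_le, mul_sub]
      constructor <;> linarith
    linarith
  exact this ▸ hσ

/-- If every pair of elements of `L` can be conjugated within `L` so as to commute elementwise with
the original pair, then homogeneous quasimorphisms are additive on `L`. -/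
theorem map_mul_of_commuting_conjugates (h : IsHomogeneousQuasimorphism ρ D) (L : Subgroup E)
    (hL : ∀ a ∈ L, ∀ b ∈ L, ∃ f ∈ L, ∀ u ∈ ({a, b} : Set E),
      ∀ v ∈ ({a, b} : Set E), Commute u (f⁻¹ * v * f)) {a b : E}
    (ha : a ∈ L) (hb : b ∈ L) : ρ (a * b) = ρ a + ρ b := by
  have key : ∀ n : ℕ, ∀ a ∈ L, ∀ b ∈ L, (2 : ℝ) ^ n * |ρ (a * b) - ρ a - ρ b| ≤ D := by
    intro n
    induction n with
    | zero => intro a _ b _; simpa using h.abs_sub_le a b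
    | succ n ih =>
      intro a ha b hb
      obtain ⟨f, hf, hcomm⟩ := hL a ha b hb
      have hconj : ∀ c, ρ (f⁻¹ * c * f) = ρ c := fun c => by simpa using h.map_conj c f⁻¹
      have hmem : ∀ c ∈ L, f⁻¹ * c * f ∈ L := fun c hc =>
        L.mul_mem (L.mul_mem (L.inv_mem hf) hc) hf
      have haa := hcomm a (by simp) a (by simp)
      have hab := hcomm a (by simp) b (by simp)
      have hba := hcomm b (by simp) a (by simp)
      have hbb := hcomm b (by simp) b (by simp)
      have hprod : f⁻¹ * (a * b) * f = f⁻¹ * a * f * (f⁻¹ * b * f) := by group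
      have hdouble : Commute (a * b) (f⁻¹ * (a * b) * f) := by
        rw [hprod]
        exact (haa.mul_left hba).mul_right (hab.mul_left hbb)
      have hmul : a * (f⁻¹ * a * f) * (b * (f⁻¹ * b * f)) = a * b * (f⁻¹ * (a * b) * f) := by
        rw [hprod, mul_assoc a, ← mul_assoc (f⁻¹ * a * f) b, ← hba.eq]
        simp only [mul_assoc]
      have h1 := ih _ (L.mul_mem ha (hmem a ha)) _ (L.mul_mem hb (hmem b hb))
      rw [hmul, h.map_mul_of_commute hdouble, h.map_mul_of_commute haa,
        h.map_mul_of_commute hbb, hconj, hconj, hconj] at h1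
      have h2 : ρ (a * b) + ρ (a * b) - (ρ a + ρ a) - (ρ b + ρ b) =
          2 * (ρ (a * b) - ρ a - ρ b) := by ring
      rw [h2, abs_mul, abs_two] at h1
      rw [pow_succ, mul_assoc]
      exact h1
  have : ρ (a * b) - ρ a - ρ b = 0 := by
    refine eq_zero_of_forall_abs_natCast_mul_le (B := D) fun n => ?_
    rw [abs_mul, Nat.abs_cast]
    refine le_trans (mul_le_mul_of_nonneg_right ?_ (abs_nonneg _)) (key n a ha b hb)
    exact_mod_cast n.lt_two_pow_self.le
  linarith

/-- A homogeneous quasimorphism that is additive on a normal subgroup `L` is additive along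
cosets of `L`. -/
theorem map_mul_of_mem (h : IsHomogeneousQuasimorphism ρ D) (L : Subgroup E) [L.Normal]
    (hL : ∀ a ∈ L, ∀ b ∈ L, ρ (a * b) = ρ a + ρ b) (x : E) {l : E} (hl : l ∈ L) :
    ρ (x * l) = ρ x + ρ l := by
  have key : ∀ n : ℕ, ∃ p ∈ L, (x * l) ^ n = x ^ n * p ∧ ρ p = n * ρ l := by
    intro n
    induction n with
    | zero => exact ⟨1, L.one_mem, by simp, by simp [h.map_one]⟩
    | succ n ih =>
      obtain ⟨p, hp, hpow, hρ⟩ := ih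
      have hp' : x⁻¹ * p * x ∈ L := by
        simpa using Subgroup.Normal.conj_mem ‹L.Normal› p hp x⁻¹
      refine ⟨x⁻¹ * p * x * l, L.mul_mem hp' hl, ?_, ?_⟩
      · rw [pow_succ, hpow, pow_succ]; group
      · have h1 := h.map_conj p x⁻¹
        rw [inv_inv] at h1
        rw [hL _ hp' _ hl, h1, hρ]
        push_cast
        ring
  have : ρ (x * l) - ρ x - ρ l = 0 := by
    refine eq_zero_of_forall_abs_natCast_mul_le (B := D) fun n => ?_
    obtain ⟨p, -, hpow, hp⟩ := key n
    have h1 := h.abs_sub_le (x ^ n) p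
    rw [← hpow, h.map_pow, h.map_pow, hp] at h1
    rwa [mul_sub, mul_sub]
  linarith

end IsHomogeneousQuasimorphism

/-- An amenable group carries a monotone, additive, normalised, left-invariant functional on
real functions of finite range. -/
theorem IsAmenableGroup.exists_mean {K : Type*} [Group K] (hK : IsAmenableGroup K) :
    ∃ J : (K → ℝ) → ℝ,
      (∀ f g, (Set.range f).Finite → (Set.range g).Finite → J (f + g) = J f + J g) ∧
      (∀ f g, (Set.range f).Finite → (Set.range g).Finite → f ≤ g → J f ≤ J g) ∧
      (∀ c, J (fun _ => c) = c) ∧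
      ∀ k f, (Set.range f).Finite → J (fun x => f (k * x)) = J f := by
  classical
  obtain ⟨m, hm0, hm1, hadd, hinv⟩ := hK
  let _ : MeasurableSpace K := ⊤
  let T : Set K → ℝ →L[ℝ] ℝ := fun s => m s • ContinuousLinearMap.id ℝ ℝ
  have hT : MeasureTheory.FinMeasAdditive (0 : MeasureTheory.Measure K) T :=
    fun s t _ _ _ _ hst => by simp only [T, hadd s t hst, add_smul]
  have hTnonneg : ∀ s, MeasurableSet s → (0 : MeasureTheory.Measure K) s < ⊤ →
      ∀ x : ℝ, 0 ≤ x → 0 ≤ T s x := fun s _ _ x hx => by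
    simpa [T] using mul_nonneg (hm0 s) hx
  let S (f : K → ℝ) (hf : (Set.range f).Finite) : MeasureTheory.SimpleFunc K ℝ :=
    ⟨f, fun _ => MeasurableSpace.measurableSet_top, hf⟩
  let J : (K → ℝ) → ℝ := fun f =>
    if hf : (Set.range f).Finite then (S f hf).setToSimpleFunc T else 0
  have hJ : ∀ f hf, J f = (S f hf).setToSimpleFunc T := fun f hf => dif_pos hf
  have hint : ∀ f hf, MeasureTheory.Integrable (S f hf) (0 : MeasureTheory.Measure K) :=
    fun f hf => MeasureTheory.integrable_zero_measure
  refine ⟨J, fun f g hf hg => ?_, fun f g hf hg hfg => ?_, fun c => ?_, fun k f hf => ?_⟩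
  · have hfg : (Set.range (f + g)).Finite := (S f hf + S g hg).finite_range
    rw [hJ f hf, hJ g hg, hJ _ hfg,
      ← MeasureTheory.SimpleFunc.setToSimpleFunc_add T hT (hint f hf) (hint g hg)]
    rfl
  · rw [hJ f hf, hJ g hg]
    exact MeasureTheory.SimpleFunc.setToSimpleFunc_mono hT hTnonneg (hint f hf) (hint g hg) hfg
  · rw [hJ _ (Set.finite_range_const)]
    have h1 := MeasureTheory.SimpleFunc.setToSimpleFunc_const' (α := K) T c (m := ⊤)
    have h2 : T Set.univ c = c := by simp [T, hm1]
    exact h1.trans h2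
  · have hrange : Set.range (fun x => f (k * x)) = Set.range f :=
      (Equiv.mulLeft k).surjective.range_comp f
    have hf' : (Set.range fun x => f (k * x)).Finite := hrange ▸ hf
    rw [hJ _ hf', hJ f hf]
    have hr : (S _ hf').range = (S f hf).range := by
      apply Finset.coe_injective
      rw [MeasureTheory.SimpleFunc.coe_range, MeasureTheory.SimpleFunc.coe_range]
      exact hrange
    unfold MeasureTheory.SimpleFunc.setToSimpleFunc
    rw [hr]
    refine Finset.sum_congr rfl fun c _ => ?_
    have hpre : (S f hf) ⁻¹' {c} = (fun x => k * x) '' ((S _ hf') ⁻¹' {c}) := by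
      ext x
      constructor
      · intro hx
        exact ⟨k⁻¹ * x, by simpa [S] using hx, by simp⟩
      · rintro ⟨y, hy, rfl⟩
        exact hy
    simp only [T, hpre, hinv]

/-- A homogeneous quasimorphism that is additive along the fibres of a surjection onto an amenable
group has defect at most `4`, whatever its original defect. -/
theorem IsHomogeneousQuasimorphism.of_amenable_quotient {E K : Type*} [Group E] [Group K]
    (hK : IsAmenableGroup K) (q : E →* K) (hq : Function.Surjective q) {ρ : E → ℝ} {D : ℝ}
    (h : IsHomogeneousQuasimorphism ρ D)
    (hker : ∀ x, ∀ l ∈ q.ker, ρ (x * l) = ρ x + ρ l) :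
    IsHomogeneousQuasimorphism ρ 4 := by
  obtain ⟨J, hJadd, hJmono, hJconst, hJinv⟩ := hK.exists_mean
  let s := Function.surjInv hq
  have hs : ∀ k, q (s k) = k := Function.surjInv_eq hq
  let F : E → K → ℝ := fun x k => ρ (x * s k) - ρ (s k)
  have hF : ∀ x e, ρ (x * e) - ρ e = F x (q e) := by
    intro x e
    have hl : (s (q e))⁻¹ * e ∈ q.ker := by simp [MonoidHom.mem_ker, hs]
    have h1 := hker (s (q e)) _ hl
    have h2 := hker (x * s (q e)) _ hl
    rw [mul_inv_cancel_left] at h1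
    rw [mul_assoc, mul_inv_cancel_left] at h2
    simp only [F]
    linarith
  have hFmul : ∀ x y k, F (x * y) k = F x (q y * k) + F y k := by
    intro x y k
    have h1 := hF x (y * s k)
    rw [map_mul, hs] at h1
    simp only [F] at h1 ⊢
    rw [← h1, mul_assoc]
    ring
  have hFbdd : ∀ x k, |F x k - ρ x| ≤ D := by
    intro x k
    have := h.abs_sub_le x (s k)
    simp only [F]
    rwa [sub_right_comm]
  let Φ : E → K → ℝ := fun x k => (⌊F x k⌋ : ℝ)
  have hΦ : ∀ x, (Set.range (Φ x)).Finite := by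
    intro x
    refine ((Set.finite_Icc ⌊ρ x - D⌋ ⌊ρ x + D⌋).image (fun n : ℤ => (n : ℝ))).subset ?_
    rintro _ ⟨k, rfl⟩
    have := abs_le.1 (hFbdd x k)
    exact ⟨⌊F x k⌋, ⟨Int.floor_mono (by linarith), Int.floor_mono (by linarith)⟩, rfl⟩
  have hconst : ∀ c : ℝ, (Set.range fun _ : K => c).Finite := fun c => Set.finite_range_const
  refine h.of_abs_sub_le (ψ := fun x => J (Φ x)) (B := D + 1) (c := 1) ?_ ?_ |> fun h => by
    simpa using h
  · intro x
    have h1 := hJmono (Φ x) (fun _ => ρ x + D) (hΦ x) (hconst _) fun k => by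
      have := abs_le.1 (hFbdd x k)
      have := Int.floor_le (F x k)
      simp only [Φ]; linarith
    have h2 := hJmono (fun _ => ρ x - D - 1) (Φ x) (hconst _) (hΦ x) fun k => by
      have := abs_le.1 (hFbdd x k)
      have := Int.lt_floor_add_one (F x k)
      simp only [Φ]; linarith
    rw [hJconst] at h1 h2
    rw [abs_le]
    constructor <;> linarith
  · intro x y
    let Ψ : K → ℝ := fun k => Φ x (q y * k)
    have hΨ : (Set.range Ψ).Finite :=
      (hΦ x).subset (Set.range_comp_subset_range (fun k => q y * k) (Φ x))
    have hsum : (Set.range (Ψ + Φ y)).Finite :=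
      (Set.Finite.image2 (· + ·) hΨ (hΦ y)).subset <| by
        rintro _ ⟨k, rfl⟩
        exact ⟨_, ⟨k, rfl⟩, _, ⟨k, rfl⟩, rfl⟩
    have hsum' : (Set.range ((Ψ + Φ y) + fun _ => (1 : ℝ))).Finite :=
      (hsum.image (· + 1)).subset <| by
        rintro _ ⟨k, rfl⟩
        exact ⟨_, ⟨k, rfl⟩, rfl⟩
    have hJΨ : J Ψ = J (Φ x) := hJinv (q y) (Φ x) (hΦ x)
    have h1 := hJmono (Ψ + Φ y) (Φ (x * y)) hsum (hΦ _) fun k => by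
      simp only [Ψ, Φ, Pi.add_apply, hFmul]
      exact_mod_cast Int.le_floor_add _ _
    have h2 := hJmono (Φ (x * y)) ((Ψ + Φ y) + fun _ => (1 : ℝ)) (hΦ _) hsum' fun k => by
      have := Int.le_floor_add_floor (F x (q y * k)) (F y k)
      simp only [Ψ, Φ, Pi.add_apply, hFmul]
      have h3 : (⌊F x (q y * k) + F y k⌋ : ℝ) - 1 ≤ ⌊F x (q y * k)⌋ + ⌊F y k⌋ := by
        exact_mod_cast this
      linarith
    rw [hJadd _ _ hΨ (hΦ y), hJΨ] at h1
    rw [hJadd _ _ hsum (hconst 1), hJadd _ _ hΨ (hΦ y), hJΨ, hJconst] at h2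
    rw [abs_le]
    constructor <;> linarith

/-- A homogeneous quasimorphism that is additive along the fibres of a surjection onto an amenable
group is a homomorphism. -/
theorem IsHomogeneousQuasimorphism.map_mul_of_amenable_quotient {E K : Type*} [Group E] [Group K]
    (hK : IsAmenableGroup K) (q : E →* K) (hq : Function.Surjective q) {ρ : E → ℝ} {D : ℝ}
    (h : IsHomogeneousQuasimorphism ρ D)
    (hker : ∀ x, ∀ l ∈ q.ker, ρ (x * l) = ρ x + ρ l) (x y : E) : ρ (x * y) = ρ x + ρ y := by
  have : ρ (x * y) - ρ x - ρ y = 0 := by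
    refine eq_zero_of_forall_abs_natCast_mul_le (B := 4) fun n => ?_
    have h1 := ((h.const_mul n.cast_nonneg).of_amenable_quotient hK q hq fun x l hl => by
      rw [hker x l hl, mul_add]).abs_sub_le x y
    rwa [mul_sub, mul_sub]
  linarith

/-- The underlying type of the central extension of `G` by `ℝ` determined by a 2-cocycle `ω`. -/
@[ext]
structure CocycleExtension_s1 {G : Type*} [Group G] (ω : G → G → ℝ) where
  /-- The component in the quotient group. -/
  fst : G
  /-- The component in the central copy of the reals. -/
  snd : ℝ

namespace CocycleExtension_s1

variable {G : Type*} [Group G] {ω : G → G → ℝ}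

/-- The group structure on the central extension determined by a 2-cocycle. -/
@[reducible]
def group (hω : ∀ g₁ g₂ g₃ : G, ω g₂ g₃ - ω (g₁ * g₂) g₃ + ω g₁ (g₂ * g₃) - ω g₁ g₂ = 0) :
    Group (CocycleExtension_s1 ω) :=
  letI : Mul (CocycleExtension_s1 ω) := ⟨fun x y => ⟨x.fst * y.fst, x.snd + y.snd + ω x.fst y.fst⟩⟩
  letI : One (CocycleExtension_s1 ω) := ⟨⟨1, -ω 1 1⟩⟩
  letI : Inv (CocycleExtension_s1 ω) := ⟨fun x => ⟨x.fst⁻¹, -x.snd - ω x.fst⁻¹ x.fst - ω 1 1⟩⟩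
  Group.ofLeftAxioms
    (fun x y z => by
      refine CocycleExtension_s1.ext (mul_assoc _ _ _) ?_
      have := hω x.fst y.fst z.fst
      change x.snd + y.snd + ω x.fst y.fst + z.snd + ω (x.fst * y.fst) z.fst =
        x.snd + (y.snd + z.snd + ω y.fst z.fst) + ω x.fst (y.fst * z.fst)
      linarith)
    (fun x => by
      refine CocycleExtension_s1.ext (one_mul _) ?_
      have := hω 1 1 x.fst
      simp only [one_mul] at this
      change -ω 1 1 + x.snd + ω 1 x.fst = x.snd
      linarith)
    (fun x => by
      refine CocycleExtension_s1.ext (inv_mul_cancel _) ?_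
      change -x.snd - ω x.fst⁻¹ x.fst - ω 1 1 + x.snd + ω x.fst⁻¹ x.fst = -ω 1 1
      ring)

end CocycleExtension_s1

/-- Let `π : E → G` be a central extension and `ρ` a homogeneous quasimorphism on `E` that vanishes
at no nontrivial element of the kernel. Elements of `E` with commuting images commute. -/
theorem IsHomogeneousQuasimorphism.commute_of_commute_map {E G : Type*} [Group E] [Group G]
    (π : E →* G) (hcentral : π.ker ≤ Subgroup.center E) {ρ : E → ℝ} {D : ℝ}
    (h : IsHomogeneousQuasimorphism ρ D) (hinj : ∀ z ∈ π.ker, ρ z = 0 → z = 1) {x y : E}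
    (hxy : Commute (π x) (π y)) : Commute x y := by
  have hz : x * y * x⁻¹ * y⁻¹ ∈ π.ker := by
    rw [MonoidHom.mem_ker, map_mul, map_mul, map_mul, hxy.eq, map_inv, map_inv]
    group
  have hzc : Commute (x * y * x⁻¹ * y⁻¹) y := (Subgroup.mem_center_iff.1 (hcentral hz) y).symm
  have h1 := h.map_mul_of_commute hzc
  rw [inv_mul_cancel_right, h.map_conj] at h1
  have h2 := hinj _ hz (by linarith)
  rwa [mul_inv_eq_one, mul_inv_eq_iff_eq_mul] at h2

/-- Let `π : E → G` be a central extension and `ρ` a homogeneous quasimorphism on `E` that vanishes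
at no nontrivial element of the kernel. If `G` is an extension of an amenable group by a group with
commuting conjugates, then `ρ` is a homomorphism. -/
theorem IsHomogeneousQuasimorphism.map_mul_of_central_extension {E G : Type*} [Group E] [Group G]
    (H : Subgroup G) [H.Normal] (hH : HasCommutingConjugates H) (hK : IsAmenableGroup (G ⧸ H))
    (π : E →* G) (hπ : Function.Surjective π) (hcentral : π.ker ≤ Subgroup.center E)
    {ρ : E → ℝ} {D : ℝ} (h : IsHomogeneousQuasimorphism ρ D)
    (hinj : ∀ z ∈ π.ker, ρ z = 0 → z = 1) (x y : E) : ρ (x * y) = ρ x + ρ y := by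
  have hL : ∀ a ∈ H.comap π, ∀ b ∈ H.comap π, ρ (a * b) = ρ a + ρ b := by
    intro a ha b hb
    refine h.map_mul_of_commuting_conjugates (H.comap π) (fun a ha b hb => ?_) ha hb
    have hfg : (Subgroup.closure {(⟨π a, ha⟩ : H), ⟨π b, hb⟩}).FG :=
      (Subgroup.fg_iff _).2 ⟨_, rfl, Set.toFinite _⟩
    obtain ⟨g, hg⟩ := hH _ hfg
    obtain ⟨f, hf⟩ := hπ g
    refine ⟨f, by simp [hf], fun u hu v hv => h.commute_of_commute_map π hcentral hinj ?_⟩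
    have hmem : ∀ u ∈ ({a, b} : Set E), ∃ u' ∈ Subgroup.closure {(⟨π a, ha⟩ : H), ⟨π b, hb⟩},
        (u' : G) = π u := by
      rintro u (rfl | rfl)
      · exact ⟨_, Subgroup.subset_closure (Set.mem_insert _ _), rfl⟩
      · exact ⟨_, Subgroup.subset_closure (Set.mem_insert_of_mem _ rfl), rfl⟩
    obtain ⟨u', hu', hu⟩ := hmem u hu
    obtain ⟨v', hv', hv⟩ := hmem v hv
    have h1 := (hg u' hu' v' hv').map H.subtype
    simpa [hf, hu, hv] using h1
  have hq : Function.Surjective ((QuotientGroup.mk' H).comp π) :=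
    (QuotientGroup.mk'_surjective H).comp hπ
  refine h.map_mul_of_amenable_quotient hK ((QuotientGroup.mk' H).comp π) hq ?_ x y
  intro x l hl
  refine h.map_mul_of_mem (H.comap π) hL x ?_
  simpa [MonoidHom.mem_ker] using hl

/-- If `H ⊴ G` has commuting conjugates and `G/H` is amenable,
then every bounded 2-cocycle on `G` is a bounded 2-coboundary, i.e. `H²_b(G;ℝ) = 0`. -/
theorem extension_commutingConjugates_amenable_vanishing_H2b
    (G : Type*) [Group G] (H : Subgroup G) [H.Normal]
    (hH : HasCommutingConjugates H)
    (hK : IsAmenableGroup (G ⧸ H))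
    (ω : G → G → ℝ) (hω : IsBounded2Cocycle ω) :
    IsBounded2Coboundary ω := by
  obtain ⟨⟨C, hC⟩, hω⟩ := hω
  let _ : Group (CocycleExtension_s1 ω) := CocycleExtension_s1.group hω
  have hmul (g h : G) (s t : ℝ) : (⟨g, s⟩ * ⟨h, t⟩ : CocycleExtension_s1 ω) =
      ⟨g * h, s + t + ω g h⟩ := rfl
  have hone : (1 : CocycleExtension_s1 ω) = ⟨1, -ω 1 1⟩ := rfl
  have hω_left (g : G) : ω 1 g = ω 1 1 := by
    have := hω 1 1 g
    simp only [one_mul] at this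
    linarith
  have hω_right (g : G) : ω g 1 = ω 1 1 := by
    have := hω g 1 1
    simp only [mul_one] at this
    linarith
  let π : CocycleExtension_s1 ω →* G :=
    { toFun := CocycleExtension_s1.fst
      map_one' := rfl
      map_mul' := fun _ _ => rfl }
  have hπ : Function.Surjective π := fun g => ⟨⟨g, 0⟩, rfl⟩
  have hcentral : π.ker ≤ Subgroup.center (CocycleExtension_s1 ω) := by
    rintro ⟨g, t⟩ (rfl : g = 1)
    rw [Subgroup.mem_center_iff]
    rintro ⟨g, s⟩
    rw [hmul, hmul, one_mul, mul_one, hω_left, hω_right, add_comm s]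
  have hdefect (x y : CocycleExtension_s1 ω) : |(x * y).snd - x.snd - y.snd| ≤ C := by
    have : (x * y).snd - x.snd - y.snd = ω x.fst y.fst := by
      change x.snd + y.snd + ω x.fst y.fst - x.snd - y.snd = _
      ring
    rw [this]
    exact hC _ _
  obtain ⟨ρ, hρ, hclose⟩ := exists_isHomogeneousQuasimorphism hdefect
  have hpow (t : ℝ) (n : ℕ) : (⟨1, t⟩ : CocycleExtension_s1 ω) ^ n =
      ⟨1, n * (t + ω 1 1) - ω 1 1⟩ := by
    induction n with
    | zero => simp [hone]
    | succ n ih =>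
      rw [pow_succ, ih, hmul, one_mul]
      congr 1
      push_cast
      ring
  have hρ_central (t : ℝ) : ρ ⟨1, t⟩ = t + ω 1 1 := by
    have : ρ ⟨1, t⟩ - (t + ω 1 1) = 0 := by
      refine eq_zero_of_forall_abs_natCast_mul_le (B := C + |ω 1 1|) fun n => ?_
      have h1 := hclose (⟨1, t⟩ ^ n)
      rw [hρ.map_pow, hpow, abs_le] at h1
      have h2 := neg_abs_le (ω 1 1)
      have h3 := le_abs_self (ω 1 1)
      rw [abs_le, mul_sub]
      constructor <;> linarith
    linarith
  have hinj : ∀ z ∈ π.ker, ρ z = 0 → z = 1 := by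
    rintro ⟨g, t⟩ (rfl : g = 1) hz
    rw [hρ_central] at hz
    rw [hone]
    congr 1
    linarith
  have hhom := hρ.map_mul_of_central_extension H hH hK π hπ hcentral hinj
  refine ⟨fun g => ρ ⟨g, 0⟩, ⟨C, fun g => by simpa using hclose ⟨g, 0⟩⟩, fun g₁ g₂ => ?_⟩
  have h1 := hhom ⟨g₁, 0⟩ ⟨g₂, 0⟩
  have h2 := hhom ⟨1, ω g₁ g₂ - ω 1 1⟩ ⟨g₁ * g₂, 0⟩
  rw [hmul] at h1
  rw [hmul, one_mul, hω_left (g₁ * g₂), hρ_central] at h2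
  simp only [add_zero, zero_add, sub_add_cancel] at h1 h2
  linarith
end

section
/- Let G be a group of increasing (orientation-preserving) homeomorphisms of the real line such that every element of G has bounded support (each g ∈ G agrees with the identity outside some compact interval) and G has no global fixed point (for every x ∈ ℝ there exists g ∈ G with g(x) ≠ x). Then G has commuting conjugates; consequently every bounded 2-cocycle on G is a bounded 2-coboundary, i.e. H²_b(G;ℝ) = 0. -/
section CommutingConjugates

variable {G : Type*} [Group G] {ω : G → G → ℝ}

/-- A bounded function that can be doubled along its domain vanishes. -/
theorem eq_zero_of_bounded_of_doubling {α : Type*} {u : α → ℝ} {C : ℝ} (hC : ∀ x, |u x| ≤ C)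
    (hu : ∀ x, ∃ y, u y = 2 * u x) (x : α) : u x = 0 := by
  have key : ∀ (n : ℕ) (x : α), 2 ^ n * |u x| ≤ C := by
    intro n
    induction n with
    | zero => simpa using hC
    | succ n ih =>
      intro x
      obtain ⟨y, hy⟩ := hu x
      have := ih y
      rw [hy, abs_mul, abs_two] at this
      rw [pow_succ]
      linarith
  by_contra hx
  have hpos : 0 < |u x| := abs_pos.mpr hx
  obtain ⟨n, hn⟩ := pow_unbounded_of_one_lt (C / |u x|) (one_lt_two (α := ℝ))
  rw [div_lt_iff₀ hpos] at hn
  exact (key n x).not_gt hn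

/-- Every bounded 2-cocycle is cohomologous to one vanishing on the diagonal. -/
theorem IsBounded2Cocycle.exists_diagonal_eq_zero (hω : IsBounded2Cocycle ω) :
    ∃ φ : G → ℝ, (∃ C : ℝ, ∀ g, |φ g| ≤ C) ∧
      IsBounded2Cocycle (fun g h => ω g h - (φ h - φ (g * h) + φ g)) ∧
      ∀ g, ω g g - (φ g - φ (g * g) + φ g) = 0 := by
  obtain ⟨⟨C, hC⟩, hcoc⟩ := hω
  let t : G → ℕ → ℝ := fun g k => ω (g ^ 2 ^ k) (g ^ 2 ^ k) / 2 / 2 ^ k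
  have ht : ∀ g k, ‖t g k‖ ≤ C / 2 / 2 ^ k := by
    intro g k
    simp only [t, norm_div, Real.norm_eq_abs, abs_two, abs_pow]
    gcongr
    exact hC _ _
  have hsum : ∀ g, Summable (t g) := fun g =>
    (summable_geometric_two' C).of_norm_bounded (ht g)
  have hbound : ∀ g, |∑' k, t g k| ≤ C := fun g =>
    tsum_of_norm_bounded (hasSum_geometric_two' C) (ht g)
  have hrec : ∀ g, ∑' k, t g k = ω g g / 2 + (∑' k, t (g * g) k) / 2 := by
    intro g
    rw [(hsum g).tsum_eq_zero_add, ← tsum_div_const]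
    congr 1
    · simp [t]
    · refine tsum_congr fun k => ?_
      have : (g * g) ^ 2 ^ k = g ^ 2 ^ (k + 1) := by
        rw [← pow_two, ← pow_mul, pow_succ']
      simp only [t, this]
      rw [pow_succ (2 : ℝ)]
      field_simp
  refine ⟨fun g => ∑' k, t g k, ⟨C, hbound⟩, ⟨⟨C + 3 * C, fun g h => ?_⟩, fun g₁ g₂ g₃ => ?_⟩,
    fun g => ?_⟩
  · have h₀ := abs_le.mp (hC g h)
    have h₁ := abs_le.mp (hbound g)
    have h₂ := abs_le.mp (hbound h)
    have h₃ := abs_le.mp (hbound (g * h))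
    exact abs_le.mpr ⟨by linarith, by linarith⟩
  · have := hcoc g₁ g₂ g₃
    simp only [mul_assoc] at this ⊢
    linarith
  · linarith [hrec g]

theorem IsBounded2Cocycle.apply_mul_mul_of_commute (hω : IsBounded2Cocycle ω) {a a' b b' : G}
    (h : Commute a' b) :
    ω (a * a') (b * b') = ω (a * b) (a' * b') + ω a b + ω a' b' - ω a a' - ω b b' +
      ω a' b - ω b a' := by
  have h₁ := hω.2 a a' (b * b')
  have h₂ := hω.2 a' b b'
  have h₃ := hω.2 a b (a' * b')
  have h₄ := hω.2 b a' b'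
  rw [← mul_assoc a' b b', h.eq] at h₁
  rw [h.eq] at h₂
  rw [← mul_assoc b a' b'] at h₃
  linarith

theorem IsBounded2Cocycle.apply_eq_of_semiconjBy (hω : IsBounded2Cocycle ω)
    (hdiag : ∀ g, ω g g = 0) {f a b : G} (h : SemiconjBy f b a) : ω a f = ω f b := by
  obtain ⟨C, hC⟩ := hω.1
  refine sub_eq_zero.mp (eq_zero_of_bounded_of_doubling
    (α := {x : G × G // SemiconjBy f x.2 x.1}) (u := fun x => ω x.1.1 f - ω f x.1.2)
    (C := 2 * C) (fun x => ?_) (fun ⟨⟨a, b⟩, h⟩ => ?_) ⟨(a, b), h⟩)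
  · have h₁ := abs_le.mp (hC x.1.1 f)
    have h₂ := abs_le.mp (hC f x.1.2)
    exact abs_le.mpr ⟨by linarith, by linarith⟩
  · refine ⟨⟨(a * a, b * b), h.mul_right h⟩, ?_⟩
    have h₁ := hω.2 a a f
    have h₂ := hω.2 f b b
    have h₃ := hω.2 a f b
    have ha := hdiag a
    have hb := hdiag b
    simp only at h ⊢
    rw [h.eq] at h₂ h₃
    linarith

theorem IsBounded2Cocycle.apply_conj (hω : IsBounded2Cocycle ω) (hdiag : ∀ g, ω g g = 0)
    {f a b a' b' : G} (h : SemiconjBy f b a) (h' : SemiconjBy f b' a') : ω b b' = ω a a' := by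
  have h₁ := hω.2 a a' f
  have h₂ := hω.2 f b b'
  have h₃ := hω.2 a f b'
  have h₄ := hω.apply_eq_of_semiconjBy hdiag h
  have h₅ := hω.apply_eq_of_semiconjBy hdiag h'
  have h₆ := hω.apply_eq_of_semiconjBy hdiag (h.mul_right h')
  rw [h.eq] at h₂
  rw [h'.eq] at h₃
  linarith

theorem IsBounded2Cocycle.apply_eq_zero_of_commute (hω : IsBounded2Cocycle ω)
    (hdiag : ∀ g, ω g g = 0) {a b : G} (h : Commute a b) : ω a b = 0 := by
  obtain ⟨C, hC⟩ := hω.1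
  refine eq_zero_of_bounded_of_doubling (α := {x : G × G // Commute x.1 x.2})
    (u := fun x => ω x.1.1 x.1.2) (fun x => hC _ _) (fun ⟨⟨a, b⟩, h⟩ => ?_) ⟨(a, b), h⟩
  simp only at h
  refine ⟨⟨(a * a, b * b), (h.mul_right h).mul_left (h.mul_right h)⟩, ?_⟩
  have h₁ := hω.apply_mul_mul_of_commute (a := a) (b' := b) h
  have h₂ := hω.apply_eq_of_semiconjBy hdiag h
  have h₃ := hdiag a
  have h₄ := hdiag b
  have h₅ := hdiag (a * b)
  simp only
  linarith

theorem HasCommutingConjugates.eq_zero_of_diagonal_eq_zero (hG : HasCommutingConjugates G)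
    (hω : IsBounded2Cocycle ω) (hdiag : ∀ g, ω g g = 0) (a b : G) : ω a b = 0 := by
  obtain ⟨C, hC⟩ := hω.1
  refine eq_zero_of_bounded_of_doubling (u := fun x : G × G => ω x.1 x.2) (fun x => hC _ _)
    (fun ⟨a, b⟩ => ?_) (a, b)
  obtain ⟨f, hf⟩ := hG (Subgroup.closure {a, b})
    ((Subgroup.fg_iff _).mpr ⟨_, rfl, Set.toFinite _⟩)
  have ha : a ∈ Subgroup.closure {a, b} := Subgroup.subset_closure (by simp)
  have hb : b ∈ Subgroup.closure {a, b} := Subgroup.subset_closure (by simp)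
  have hconj : ∀ x, SemiconjBy f (f⁻¹ * x * f) x := fun x => by
    simp [SemiconjBy, mul_assoc]
  refine ⟨(a * (f⁻¹ * a * f), b * (f⁻¹ * b * f)), ?_⟩
  have hab := hf _ (mul_mem ha hb) _ (mul_mem ha hb)
  rw [show f⁻¹ * (a * b) * f = (f⁻¹ * a * f) * (f⁻¹ * b * f) by group] at hab
  have hba := hf b hb a ha
  have h₁ := hω.apply_mul_mul_of_commute (a := a) (b' := f⁻¹ * b * f) hba.symm
  have h₂ := hω.apply_eq_zero_of_commute hdiag hab
  have h₃ := hω.apply_eq_zero_of_commute hdiag (hf a ha a ha)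
  have h₄ := hω.apply_eq_zero_of_commute hdiag (hf b hb b hb)
  have h₅ := hω.apply_eq_zero_of_commute hdiag hba
  have h₆ := hω.apply_eq_zero_of_commute hdiag hba.symm
  have h₇ := hω.apply_conj hdiag (hconj a) (hconj b)
  simp only
  linarith

theorem HasCommutingConjugates.hasVanishingH2b (hG : HasCommutingConjugates G) :
    HasVanishingH2b G := by
  intro ω hω
  obtain ⟨φ, hφ, hcoc, hdiag⟩ := hω.exists_diagonal_eq_zero
  exact ⟨φ, hφ, fun g h => sub_eq_zero.mp (hG.eq_zero_of_diagonal_eq_zero hcoc hdiag g h)⟩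

end CommutingConjugates

section RealLine

variable {G : Subgroup (Equiv.Perm ℝ)}

/-- Without global fixed points, orbits are unbounded above. -/
theorem exists_lt_apply_of_noGlobalFix (hmono : ∀ g ∈ G, StrictMono ⇑g)
    (hnofix : ∀ x : ℝ, ∃ g ∈ G, g x ≠ x) (a b : ℝ) : ∃ g ∈ G, b < g a := by
  by_contra! hb
  let O : Set ℝ := {y | ∃ g ∈ G, g a = y}
  have hlub : IsLUB O (sSup O) :=
    isLUB_csSup ⟨a, 1, one_mem G, rfl⟩ ⟨b, by rintro _ ⟨g, hg, rfl⟩; exact hb g hg⟩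
  have hle : ∀ g ∈ G, sSup O ≤ g (sSup O) := by
    intro g hg
    refine hlub.2 ?_
    rintro _ ⟨k, hk, rfl⟩
    have h₁ : g⁻¹ (k a) ≤ sSup O := hlub.1 ⟨g⁻¹ * k, mul_mem (inv_mem hg) hk, rfl⟩
    simpa using (hmono g hg).monotone h₁
  obtain ⟨g, hg, hne⟩ := hnofix (sSup O)
  refine hne (le_antisymm ?_ (hle g hg))
  simpa using (hmono g hg).monotone (hle g⁻¹ (inv_mem hg))

/-- A finitely generated group of boundedly supported permutations has bounded support. -/
theorem exists_support_subset_Icc_of_fg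
    (hbdd : ∀ g ∈ G, ∃ a b : ℝ, ∀ x : ℝ, x ∉ Set.Icc a b → g x = x)
    {H : Subgroup G} (hH : H.FG) :
    ∃ a b : ℝ, ∀ h ∈ H, ∀ x ∉ Set.Icc a b, (h : Equiv.Perm ℝ) x = x := by
  obtain ⟨S, rfl⟩ := hH
  choose a b hab using fun g : G => hbdd g g.2
  obtain ⟨A, hA⟩ := (S.finite_toSet.image a).bddBelow
  obtain ⟨B, hB⟩ := (S.finite_toSet.image b).bddAbove
  refine ⟨A, B, fun h hh x hx => ?_⟩
  have hle : Subgroup.closure (S : Set G) ≤ MulAction.stabilizer G x := by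
    refine (Subgroup.closure_le _).mpr fun s hs => hab s x fun hx' => hx ?_
    exact ⟨(hA ⟨s, hs, rfl⟩).trans hx'.1, hx'.2.trans (hB ⟨s, hs, rfl⟩)⟩
  exact hle hh

theorem hasCommutingConjugates_of_boundedlySupported (hmono : ∀ g ∈ G, StrictMono ⇑g)
    (hbdd : ∀ g ∈ G, ∃ a b : ℝ, ∀ x : ℝ, x ∉ Set.Icc a b → g x = x)
    (hnofix : ∀ x : ℝ, ∃ g ∈ G, g x ≠ x) : HasCommutingConjugates G := by
  intro H hH
  obtain ⟨a, b, hab⟩ := exists_support_subset_Icc_of_fg hbdd hH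
  obtain ⟨g, hg, hgab⟩ := exists_lt_apply_of_noGlobalFix hmono hnofix a b
  refine ⟨⟨g, hg⟩⁻¹, fun h₁ hh₁ h₂ hh₂ => Subtype.ext (Equiv.Perm.Disjoint.commute ?_)⟩
  intro x
  by_cases hx : x ≤ b
  · right
    have hlt : g⁻¹ x < a := (hmono g hg).lt_iff_lt.mp (by simpa using hx.trans_lt hgab)
    have := hab h₂ hh₂ (g⁻¹ x) fun h => hlt.not_ge h.1
    change g ((h₂ : Equiv.Perm ℝ) (g⁻¹ x)) = x
    rw [this]
    exact g.apply_symm_apply x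
  · exact Or.inl (hab h₁ hh₁ x fun h => hx h.2)

end RealLine

/-- A group of orientation-preserving homeomorphisms of the real
line (equivalently, strictly increasing bijections of `ℝ`), each of whose elements
has bounded support, and having no global fixed point, has commuting conjugates;
consequently every bounded 2-cocycle on it is a bounded 2-coboundary, i.e.
`H²_b(G;ℝ) = 0`. -/
theorem boundedlySupported_noGlobalFix_commutingConjugates_vanishing_H2b
    (G : Subgroup (Equiv.Perm ℝ))
    (hmono : ∀ g ∈ G, StrictMono ⇑g)
    (hbdd : ∀ g ∈ G, ∃ a b : ℝ, ∀ x : ℝ, x ∉ Set.Icc a b → g x = x)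
    (hnofix : ∀ x : ℝ, ∃ g ∈ G, g x ≠ x) :
    HasCommutingConjugates G ∧
      ∀ ω : G → G → ℝ, IsBounded2Cocycle ω → IsBounded2Coboundary ω := by
  have hG := hasCommutingConjugates_of_boundedlySupported hmono hbdd hnofix
  exact ⟨hG, hG.hasVanishingH2b⟩
end

section
/- Let G be a group and let ω : G × G → ℝ be a bounded homogeneous 2-cocycle. Then for all h, k ∈ G one has ω(k⁻¹, h) + ω(k⁻¹h, k) = 0. (Equivalently, in the central extension of G by ℝ determined by ω, the canonical normalized section σ satisfies σ(k⁻¹hk) = σ(k)⁻¹σ(h)σ(k) for all h, k ∈ G.) -/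
/-- A bounded 2-cocycle is homogeneous if it vanishes on powers of a single
element: `ω(gⁱ, gʲ) = 0` for all `g` and all integers `i, j`. -/
def IsHomogeneous2Cocycle {G : Type*} [Group G] (ω : G → G → ℝ) : Prop :=
  ∀ (g : G) (i j : ℤ), ω (g ^ i) (g ^ j) = 0

/-- The failure of the canonical section to be equivariant under conjugation by `k` is additive
up to the values of `ω` on the arguments and on their conjugates. -/
theorem IsHomogeneous2Cocycle.conj_defect_mul {G : Type*} [Group G] {ω : G → G → ℝ}
    (hω : IsBounded2Cocycle ω) (hhom : IsHomogeneous2Cocycle ω) (k a b : G) :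
    (ω k⁻¹ (a * b) + ω (k⁻¹ * (a * b)) k) + ω a b =
      (ω k⁻¹ a + ω (k⁻¹ * a) k) + (ω k⁻¹ b + ω (k⁻¹ * b) k) +
        ω (k⁻¹ * a * k) (k⁻¹ * b * k) := by
  have h₁ := hω.2 (k⁻¹ * a * k) (k⁻¹ * b) k
  have h₂ := hω.2 (k⁻¹ * a * k) k⁻¹ b
  have h₃ := hω.2 (k⁻¹ * a) k k⁻¹
  have h₄ := hω.2 k⁻¹ a b
  have hk : ω k k⁻¹ = 0 := by simpa using hhom k 1 (-1)
  have h_one : ω (k⁻¹ * a) 1 = 0 := by simpa using hhom (k⁻¹ * a) 1 0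
  simp only [mul_assoc, mul_inv_cancel, mul_inv_cancel_left, mul_one] at *
  linarith

/-- The conjugation defect is linear on powers of a single element. -/
theorem IsHomogeneous2Cocycle.conj_defect_pow {G : Type*} [Group G] {ω : G → G → ℝ}
    (hω : IsBounded2Cocycle ω) (hhom : IsHomogeneous2Cocycle ω) (h k : G) (n : ℕ) :
    ω k⁻¹ (h ^ n) + ω (k⁻¹ * h ^ n) k = n * (ω k⁻¹ h + ω (k⁻¹ * h) k) := by
  induction n with
  | zero =>
    have h₁ : ω k⁻¹ 1 = 0 := by simpa using hhom k⁻¹ 1 0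
    have h₂ : ω k⁻¹ k = 0 := by simpa using hhom k (-1) 1
    simp [h₁, h₂]
  | succ n ih =>
    have hmul := hhom.conj_defect_mul hω k (h ^ n) h
    have hpow : ω (h ^ n) h = 0 := by simpa using hhom h n 1
    have hconj : ω (k⁻¹ * h ^ n * k) (k⁻¹ * h * k) = 0 := by
      have := hhom (k⁻¹ * h * k) n 1
      have e : (k⁻¹ * h * k) ^ n = k⁻¹ * h ^ n * k := by
        simpa using conj_pow (a := k⁻¹) (b := h) (i := n)
      simpa only [zpow_natCast, zpow_one, e] using this
    rw [pow_succ]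
    push_cast
    linarith

/-- For a bounded homogeneous 2-cocycle `ω` on a group `G`, one
has `ω(k⁻¹, h) + ω(k⁻¹h, k) = 0` for all `h, k ∈ G` (equivalently, the canonical
section of the associated central extension is conjugation-equivariant). -/
theorem homogeneous2Cocycle_conj (G : Type*) [Group G] (ω : G → G → ℝ)
    (hω : IsBounded2Cocycle ω) (hhom : IsHomogeneous2Cocycle ω) (h k : G) :
    ω k⁻¹ h + ω (k⁻¹ * h) k = 0 := by
  obtain ⟨C, hC⟩ := hω.1
  by_contra hne
  obtain ⟨n, hn⟩ := exists_nat_gt (2 * C / |ω k⁻¹ h + ω (k⁻¹ * h) k|)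
  rw [div_lt_iff₀ (abs_pos.mpr hne), ← Nat.abs_cast n, ← abs_mul,
    ← hhom.conj_defect_pow hω] at hn
  linarith [abs_add_le (ω k⁻¹ (h ^ n)) (ω (k⁻¹ * h ^ n) k), hC k⁻¹ (h ^ n),
    hC (k⁻¹ * h ^ n) k]
end

section
/- Let G be a group, let ω : G × G → ℝ be a bounded homogeneous 2-cocycle, and let H ≤ G be a subgroup such that every bounded 2-cocycle on H is a bounded 2-coboundary (i.e. H²_b(H;ℝ) = 0). Then ω(h₁, h₂) = 0 for all h₁, h₂ ∈ H. In particular, every bounded homogeneous 2-cocycle on G vanishes on all pairs of elements of any abelian subgroup of G. -/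
theorem eq_zero_of_abs_natCast_mul_le {x C : ℝ} (h : ∀ n : ℕ, |n * x| ≤ C) : x = 0 := by
  by_contra hx
  obtain ⟨n, hn⟩ := exists_nat_gt (C / |x|)
  have hlt := (div_lt_iff₀ (abs_pos.mpr hx)).mp hn
  have hle := h n
  rw [abs_mul, Nat.abs_cast] at hle
  exact absurd hle (not_le.mpr hlt)

namespace IsHomogeneous2Cocycle

variable {G : Type*} [Group G] {ω : G → G → ℝ}

theorem pow_pow (hhom : IsHomogeneous2Cocycle ω) (g : G) (m n : ℕ) :
    ω (g ^ m) (g ^ n) = 0 := by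
  simpa only [zpow_natCast] using hhom g m n

theorem one_left (hhom : IsHomogeneous2Cocycle ω) (g : G) : ω 1 g = 0 := by
  simpa using hhom.pow_pow g 0 1

theorem one_right (hhom : IsHomogeneous2Cocycle ω) (g : G) : ω g 1 = 0 := by
  simpa using hhom.pow_pow g 1 0

theorem pow_self (hhom : IsHomogeneous2Cocycle ω) (g : G) (n : ℕ) : ω (g ^ n) g = 0 := by
  simpa using hhom.pow_pow g n 1

/-- A homogeneous cocycle which is a bounded coboundary is zero: a bounded primitive
is additive on powers, hence vanishes. -/
theorem eq_zero_of_isBounded2Coboundary (hhom : IsHomogeneous2Cocycle ω)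
    (hω : IsBounded2Coboundary ω) (g h : G) : ω g h = 0 := by
  obtain ⟨φ, ⟨C, hC⟩, hφ⟩ := hω
  have hpow (g : G) (n : ℕ) : φ (g ^ n) = n * φ g := by
    induction n with
    | zero =>
      have h1 := hφ 1 1
      rw [hhom.one_left, mul_one] at h1
      simpa using h1.symm
    | succ n ih =>
      have h1 := hφ (g ^ n) g
      rw [hhom.pow_self, ← pow_succ] at h1
      push_cast
      linarith
  have hzero (g : G) : φ g = 0 :=
    eq_zero_of_abs_natCast_mul_le (C := C) fun n => hpow g n ▸ hC (g ^ n)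
  simp [hφ, hzero]

/-- The antisymmetrization of a bounded homogeneous cocycle is additive in commuting
variables, and hence vanishes. -/
theorem symm_of_commute (hhom : IsHomogeneous2Cocycle ω) (hω : IsBounded2Cocycle ω)
    {a b : G} (hab : Commute a b) : ω a b = ω b a := by
  obtain ⟨⟨C, hC⟩, hcoc⟩ := hω
  have hpow (n : ℕ) : ω (a ^ n) b - ω b (a ^ n) = n * (ω a b - ω b a) := by
    induction n with
    | zero => simp [hhom.one_left, hhom.one_right]
    | succ n ih =>
      have h₁ := hcoc (a ^ n) a b
      have h₂ := hcoc b (a ^ n) a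
      have h₃ := hcoc (a ^ n) b a
      rw [hab.eq] at h₁
      rw [(hab.pow_left n).eq] at h₃
      rw [pow_succ]
      push_cast
      linarith
  refine sub_eq_zero.mp (eq_zero_of_abs_natCast_mul_le (C := C + C) fun n => ?_)
  rw [← hpow n]
  exact (abs_sub _ _).trans (add_le_add (hC _ _) (hC _ _))

/-- For commuting `a` and `b` one has `ω (a ^ n) (b ^ n) = n * ω a b`, so boundedness
forces `ω a b = 0`. -/
theorem eq_zero_of_commute (hhom : IsHomogeneous2Cocycle ω) (hω : IsBounded2Cocycle ω)
    {a b : G} (hab : Commute a b) : ω a b = 0 := by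
  have hsymm (n : ℕ) := hhom.symm_of_commute hω (hab.pow_right n)
  obtain ⟨⟨C, hC⟩, hcoc⟩ := hω
  have hpow (n : ℕ) : ω (a ^ n) (b ^ n) = n * ω a b := by
    induction n with
    | zero => simp [hhom.one_left]
    | succ n ih =>
      have h₁ := hcoc (a ^ n) a (b ^ n * b)
      have h₂ := hcoc (a ^ n) (b ^ n) (a * b)
      have h₃ := hcoc a (b ^ n) b
      have h₄ := hcoc (b ^ n) a b
      have hc := (hab.pow_right n).eq
      rw [← mul_assoc a, hc, mul_assoc] at h₁
      rw [hc] at h₃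
      rw [← hab.mul_pow] at h₂
      have h₅ := hhom.pow_self (a * b) n
      have h₆ := hhom.pow_self a n
      have h₇ := hhom.pow_self b n
      have h₈ := hsymm n
      rw [pow_succ, pow_succ]
      push_cast
      linarith
  exact eq_zero_of_abs_natCast_mul_le (C := C) fun n => hpow n ▸ hC _ _

end IsHomogeneous2Cocycle

/-- A bounded homogeneous 2-cocycle `ω` on `G` vanishes on all
pairs of elements of a subgroup `H` with `H²_b(H;ℝ) = 0`; in particular `ω`
vanishes on all pairs of elements of any abelian subgroup of `G`. -/
theorem homogeneous2Cocycle_vanishes_on_boundedlyAcyclic_subgroup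
    (G : Type*) [Group G] (ω : G → G → ℝ)
    (hω : IsBounded2Cocycle ω) (hhom : IsHomogeneous2Cocycle ω)
    (H : Subgroup G) (hH : HasVanishingH2b H) :
    (∀ h₁ ∈ H, ∀ h₂ ∈ H, ω h₁ h₂ = 0) ∧
      ∀ A : Subgroup G, (∀ a ∈ A, ∀ b ∈ A, a * b = b * a) →
        ∀ a ∈ A, ∀ b ∈ A, ω a b = 0 := by
  refine ⟨fun h₁ hh₁ h₂ hh₂ => ?_, fun A hA a ha b hb =>
    hhom.eq_zero_of_commute hω (hA a ha b hb)⟩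
  have hhomH : IsHomogeneous2Cocycle fun x y : H => ω x y := fun g i j => by
    simpa using hhom g i j
  have hωH : IsBounded2Cocycle fun x y : H => ω x y :=
    ⟨hω.1.imp fun C hC x y => hC x y, fun x y z => hω.2 x y z⟩
  exact hhomH.eq_zero_of_isBounded2Coboundary (hH _ hωH) ⟨h₁, hh₁⟩ ⟨h₂, hh₂⟩
end
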